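/- arXiv:2510.14734 — 2 statements merged into one kernel-verified Lean document; each statement's English description precedes it below -/
import Mathlib

section
/- Let ξ be a random variable taking values in (0,∞) with E[ξ²] < ∞, let (l(n))_{n∈ℕ} be positive reals with l(n) → ∞, and let ρ_n be the law of ⌊l(n)·ξ⌋. Then (ρ_n)_{n∈ℕ} is an appropriate family. In particular, the family (δ_n)_{n∈ℕ} of Dirac masses at n and the family (Geo(1/(n+1)))_{n∈ℕ}, where Geo(λ)(k) = λ(1−λ)^k, are appropriate families. -/
open MeasureTheory ProbabilityTheory Filter Topology
open scoped ENNReal NNReal Classical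

noncomputable section

namespace FRIPaper

/-- The lattice `ℤ^d`. -/
abbrev Zd (d : ℕ) := Fin d → ℤ

/-- `x` and `y` are nearest neighbours in `ℤ^d` (`ℓ¹`-distance one). -/
def IsNN {d : ℕ} (x y : Zd d) : Prop := (∑ i, (x i - y i).natAbs) = 1

/-- Event that a one-sided path never visits `A` at a positive time
(i.e. `H̃_A = ∞` for the path started anywhere). -/
def NoReturn {d : ℕ} (A : Set (Zd d)) : Set (ℕ → Zd d) := {ω | ∀ t : ℕ, 0 < t → ω t ∉ A}

/-- Event that a one-sided path does not visit `A` at a positive time `t ≤ s`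
(i.e. `H̃_A > s`). -/
def NoReturnUpTo {d : ℕ} (A : Set (Zd d)) (s : ℝ) : Set (ℕ → Zd d) :=
  {ω | ∀ t : ℕ, 0 < t → (t : ℝ) ≤ s → ω t ∉ A}

/-- Specification of the law `P^x` of the discrete-time simple random walk on `ℤ^d`
started at `x`, as a measure on the path space `ℕ → ℤ^d`: it is the unique probability
measure giving each nearest-neighbour cylinder of length `T` based at `x`
probability `(2d)^{-T}`. -/
def IsSRW (d : ℕ) (x : Zd d) (P : Measure (ℕ → Zd d)) : Prop :=
  IsProbabilityMeasure P ∧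
    ∀ (T : ℕ) (w : ℕ → Zd d),
      P {ω | ∀ t ≤ T, ω t = w t} =
        if w 0 = x ∧ ∀ t < T, IsNN (w t) (w (t + 1)) then
          (((2 * d : ℕ) : ℝ≥0∞))⁻¹ ^ T else 0

/-- A family `P x`, `x ∈ ℤ^d`, of simple random walk laws. -/
def IsSRWFamily (d : ℕ) (P : Zd d → Measure (ℕ → Zd d)) : Prop := ∀ x, IsSRW d x (P x)

/-- Equilibrium measure `e_A(x) = P^x[H̃_A = ∞] 1_{x ∈ A}`. -/
def equil {d : ℕ} (P : Zd d → Measure (ℕ → Zd d)) (A : Set (Zd d)) (x : Zd d) : ℝ :=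
  if x ∈ A then (P x (NoReturn A)).toReal else 0

/-- Capacity `cap(A) = Σ_{x∈A} e_A(x)`. -/
def capacity {d : ℕ} (P : Zd d → Measure (ℕ → Zd d)) (A : Finset (Zd d)) : ℝ :=
  ∑ x ∈ A, equil P (↑A) x

/-- Truncated capacity `cap(A,T) = Σ_{x∈A} P^x[H̃_A > T·(log T)^{-10}]`. -/
def capTrunc {d : ℕ} (P : Zd d → Measure (ℕ → Zd d)) (A : Finset (Zd d)) (T : ℝ) : ℝ :=
  ∑ x ∈ A, (P x (NoReturnUpTo (↑A) (T / (Real.log T) ^ (10 : ℕ)))).toReal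

/-- `X[a,b]`, the set of points visited by the path between times `a` and `b`. -/
def walkRange {d : ℕ} (ω : ℕ → Zd d) (a b : ℕ) : Finset (Zd d) := (Finset.Icc a b).image ω

/-- `E^0[cap(X[0,T])]`. -/
def capExpect {d : ℕ} (P : Zd d → Measure (ℕ → Zd d)) (T : ℕ) : ℝ :=
  ∫ ω, capacity P (walkRange ω 0 T) ∂ (P 0)

/-- `1 + log x · 1_{d = 4}`. -/
def logFour (d : ℕ) (x : ℝ) : ℝ := 1 + if d = 4 then Real.log x else 0

/-- `ε` is the constant `ε_d = lim_{T→∞} E^0[cap(X[0,T])]·T^{-1}·(1 + log T·1_{d=4})`,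
which lies in `(0,∞)`. -/
def IsCapLimit (d : ℕ) (P : Zd d → Measure (ℕ → Zd d)) (ε : ℝ) : Prop :=
  0 < ε ∧ Tendsto (fun T : ℕ => capExpect P T * logFour d T / (T : ℝ)) atTop (𝓝 ε)

/-! ### Distributions on `ℕ` -/

/-- `ρ` is a probability distribution on `ℕ`. -/
def IsDist (ρ : ℕ → ℝ) : Prop := (∀ k, 0 ≤ ρ k) ∧ HasSum ρ 1

/-- `k`-th moment `μ_k(ρ)`. -/
def mu (k : ℕ) (ρ : ℕ → ℝ) : ℝ := ∑' l : ℕ, (l : ℝ) ^ k * ρ l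

/-- Tail `μ_k^{(m)}(ρ) = Σ_{l ≥ m} l^k ρ(l)`. -/
def muTail (k m : ℕ) (ρ : ℕ → ℝ) : ℝ := ∑' l : ℕ, if m ≤ l then (l : ℝ) ^ k * ρ l else 0

/-- An appropriate family of distributions on `ℕ`. -/
def Appropriate (ρ : ℕ → ℕ → ℝ) : Prop :=
  (∀ n, IsDist (ρ n)) ∧
  (∀ n, Summable fun l : ℕ => (l : ℝ) ^ 2 * ρ n l) ∧
  Tendsto (fun n => mu 1 (ρ n)) atTop atTop ∧
  ∀ ε : ℝ, 0 < ε → ∃ C : ℝ,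
    ∀ n, (∑' L : ℕ, if C * mu 1 (ρ n) ≤ (L : ℝ) then (L : ℝ) ^ 2 * ρ n L / mu 2 (ρ n) else 0) ≤ ε

/-- Geometric distribution `Geo(λ)(k) = λ (1-λ)^k`. -/
def geo (lam : ℝ) (k : ℕ) : ℝ := lam * (1 - lam) ^ k

/-! ### Trajectories and finitary random interlacements -/

/-- A finite trajectory in `ℤ^d`, recorded as the list of its positions. -/
abbrev Traj (d : ℕ) := List (Zd d)

/-- A point configuration: the multiplicity of each trajectory. -/
abbrev Config (d : ℕ) := Traj d → ℕ

/-- A valid trajectory: a nonempty nearest-neighbour path. -/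
def ValidTraj {d : ℕ} (η : Traj d) : Prop := η ≠ [] ∧ η.Chain' IsNN

/-- The time length `T(η)` of a trajectory. -/
def len {d : ℕ} (η : Traj d) : ℕ := η.length - 1

/-- The range of a trajectory, as a set. -/
def rangeSet {d : ℕ} (η : Traj d) : Set (Zd d) := {y | y ∈ η}

/-- The trajectory `η` visits the set `A`. -/
def hits {d : ℕ} (η : Traj d) (A : Set (Zd d)) : Prop := ∃ y ∈ η, y ∈ A

/-- Poisson probability mass `e^{-r} r^n / n!`. -/
def poissonProb (r : ℝ) (n : ℕ) : ℝ≥0∞ :=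
  ENNReal.ofReal (Real.exp (-r) * r ^ n / n.factorial)

/-- The intensity `u·π({η})` that FRI with parameters `(u,ρ)` puts on a single
trajectory `η`: trajectories of length `l` from each starting point carry mass
`u·ρ(l)/(μ₁(ρ)+1)·(2d)^{-l}` each. -/
def friIntensity (d : ℕ) (u : ℝ) (ρ : ℕ → ℝ) (η : Traj d) : ℝ :=
  if ValidTraj η then u * ρ (len η) / (mu 1 ρ + 1) * (1 / (2 * (d : ℝ))) ^ (len η) else 0

/-- `P` is the law of a Poisson point process on the countable set of trajectories
with intensity function `ι`: the multiplicities of distinct trajectories are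
independent Poisson random variables. -/
def IsPoissonPP (d : ℕ) (ι : Traj d → ℝ) (P : Measure (Config d)) : Prop :=
  IsProbabilityMeasure P ∧
    ∀ (F : Finset (Traj d)) (k : Traj d → ℕ),
      P {ω | ∀ η ∈ F, ω η = k η} = ∏ η ∈ F, poissonProb (ι η) (k η)

/-- `P` is the law of the finitary random interlacements point process `𝒳^{u,ρ}`. -/
def IsFRI (d : ℕ) (u : ℝ) (ρ : ℕ → ℝ) (P : Measure (Config d)) : Prop :=
  IsPoissonPP d (friIntensity d u ρ) P

/-- `J` is the law of an i.i.d. sequence of copies of `𝒳^{u,ρ}`. -/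
def IsFRIseq (d : ℕ) (u : ℝ) (ρ : ℕ → ℝ) (J : Measure (ℕ → Config d)) : Prop :=
  IsProbabilityMeasure J ∧
    ∀ (F : Finset (ℕ × Traj d)) (k : ℕ × Traj d → ℕ),
      J {j | ∀ p ∈ F, j p.1 p.2 = k p} = ∏ p ∈ F, poissonProb (friIntensity d u ρ p.2) (k p)

/-! ### Percolation -/

/-- The edge `{x,y}` is traversed by some trajectory of the configuration `ω`. -/
def EdgeOpen {d : ℕ} (ω : Config d) (x y : Zd d) : Prop :=
  ∃ η : Traj d, 0 < ω η ∧ ∃ i : ℕ,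
    (η[i]? = some x ∧ η[i + 1]? = some y) ∨ (η[i]? = some y ∧ η[i + 1]? = some x)

/-- The cluster of `x` in the subgraph `ℐ` induced by the configuration `ω`. -/
def Cluster {d : ℕ} (ω : Config d) (x : Zd d) : Set (Zd d) :=
  {y | Relation.ReflTransGen (EdgeOpen ω) x y}

/-- The origin lies in an infinite cluster. -/
def PercEvent (d : ℕ) : Set (Config d) := {ω | (Cluster ω 0).Infinite}

/-- The critical intensity `u_*(ρ)`, given the family `u ↦ 𝒳^{u,ρ}`. -/
def uStar (d : ℕ) (X : ℝ → Measure (Config d)) : ℝ :=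
  sInf {u : ℝ | 0 ≤ u ∧ 0 < X u (PercEvent d)}

/-- The order `u_n = μ₁(ρ)·(1 + log μ₁(ρ)·1_{d=4}) / (ε_d·μ₂(ρ))` of the
critical intensity. -/
def uN (d : ℕ) (εd : ℝ) (ρ : ℕ → ℝ) : ℝ :=
  mu 1 ρ * logFour d (mu 1 ρ) / (εd * mu 2 ρ)

/-! ### `ρ`-capacity, Green function, `κ` and `φ` -/

/-- `e_A^{(ρ)}(x) = Σ_m (μ₀^{(m)}(ρ)/(μ₁(ρ)+1))·P^x[H̃_A > m]`. -/
def equilRho {d : ℕ} (P : Zd d → Measure (ℕ → Zd d)) (ρ : ℕ → ℝ) (A : Set (Zd d))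
    (x : Zd d) : ℝ :=
  ∑' m : ℕ, (muTail 0 m ρ / (mu 1 ρ + 1)) * (P x (NoReturnUpTo A (m : ℝ))).toReal

/-- `cap^{(ρ)}(A) = Σ_{x∈A} e_A^{(ρ)}(x)`. -/
def capRho {d : ℕ} (P : Zd d → Measure (ℕ → Zd d)) (ρ : ℕ → ℝ) (A : Finset (Zd d)) : ℝ :=
  ∑ x ∈ A, equilRho P ρ (↑A) x

/-- Green's function `g(x,y) = Σ_t P^x[X_t = y]`. -/
def green {d : ℕ} (P : Zd d → Measure (ℕ → Zd d)) (x y : Zd d) : ℝ :=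
  ∑' t : ℕ, (P x {ω | ω t = y}).toReal

/-- `φ^{(ρ)}(A,B) = Σ_{x∈A} Σ_{y∈B} e_A^{(ρ)}(x) e_B^{(ρ)}(y) g(x,y)`. -/
def phiRho {d : ℕ} (P : Zd d → Measure (ℕ → Zd d)) (ρ : ℕ → ℝ) (A B : Finset (Zd d)) : ℝ :=
  ∑ x ∈ A, ∑ y ∈ B, equilRho P ρ (↑A) x * equilRho P ρ (↑B) y * green P x y

/-- `κ^{(ρ)}(A) = Σ_{x∈A} Σ_m (μ₁^{(m)}(ρ)/μ₂(ρ))·P^x[H̃_A > m]` (real-valued,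
for finite `A`). -/
def kappa {d : ℕ} (P : Zd d → Measure (ℕ → Zd d)) (ρ : ℕ → ℝ) (A : Finset (Zd d)) : ℝ :=
  ∑ x ∈ A, ∑' m : ℕ, (muTail 1 m ρ / mu 2 ρ) * (P x (NoReturnUpTo (↑A) (m : ℝ))).toReal

/-- `κ^{(ρ)}(A)` as an extended-real valued quantity, for arbitrary `A`. -/
def kappaE {d : ℕ} (P : Zd d → Measure (ℕ → Zd d)) (ρ : ℕ → ℝ) (A : Set (Zd d)) : ℝ≥0∞ :=
  ∑' x : Zd d,
    A.indicator (fun x => ∑' m : ℕ,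
      ENNReal.ofReal (muTail 1 m ρ / mu 2 ρ) * P x (NoReturnUpTo A (m : ℝ))) x

/-! ### Exploration processes -/

/-- First components: the `k`-th layer `L_k` of vertices; second components:
`∪_{i<k} L_i`.  Layer `L_{k+1}` is spanned by the trajectories of `ω` meeting `L_k`
but not `∪_{i<k} L_i`. -/
def exploreSets {d : ℕ} (ω : Config d) : ℕ → Set (Zd d) × Set (Zd d)
  | 0 => ({0}, ∅)
  | k + 1 =>
    ({y | ∃ η : Traj d, 0 < ω η ∧ hits η (exploreSets ω k).1 ∧
        ¬ hits η (exploreSets ω k).2 ∧ y ∈ η},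
      (exploreSets ω k).1 ∪ (exploreSets ω k).2)

/-- The `i`-th layer `𝓛_i` of trajectories of the exploration of the cluster of the
origin, as a sub-configuration of `ω`. -/
def exploreLayer {d : ℕ} (ω : Config d) : ℕ → Config d
  | 0 => fun _ => 0
  | k + 1 => fun η =>
      if hits η (exploreSets ω k).1 ∧ ¬ hits η (exploreSets ω k).2 then ω η else 0

/-- The vertex sets `L'_k` of the dominating exploration driven by the i.i.d.
sequence `j`. -/
def exploreSets' {d : ℕ} (j : ℕ → Config d) : ℕ → Set (Zd d)
  | 0 => {0}
  | k + 1 => {y | ∃ η : Traj d, 0 < j (k + 1) η ∧ hits η (exploreSets' j k) ∧ y ∈ η}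

/-- The trajectory layers `𝓛'_i` of the dominating exploration. -/
def exploreLayer' {d : ℕ} (j : ℕ → Config d) : ℕ → Config d
  | 0 => fun _ => 0
  | k + 1 => fun η => if hits η (exploreSets' j k) then j (k + 1) η else 0

/-- `W_k = 𝔼[κ^{(ρ)}(L'_k)]`. -/
def Wexp {d : ℕ} (P : Zd d → Measure (ℕ → Zd d)) (ρ : ℕ → ℝ)
    (J : Measure (ℕ → Config d)) (k : ℕ) : ℝ≥0∞ :=
  ∫⁻ j, kappaE P ρ (exploreSets' j k) ∂ J

/-- `V_k = 𝔼[|L'_k|]`, multiplied by `(log μ₁(ρ))⁻¹` when `d = 4`. -/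
def Vexp (d : ℕ) (ρ : ℕ → ℝ) (J : Measure (ℕ → Config d)) (k : ℕ) : ℝ≥0∞ :=
  (if d = 4 then ENNReal.ofReal (1 / Real.log (mu 1 ρ)) else 1) *
    ∫⁻ j, ENat.toENNReal (exploreSets' j k).encard ∂ J

/-! ### Two-sided finite random walk trajectories -/

/-- `μ(x,m,l)({η})`: the two-sided path `(X_{-m},…,X_l)` of a doubly infinite walk
with `X_0 = x` equals the list `η` (of length `m+l+1`, with `η[m] = x`)
with probability `(2d)^{-(m+l)}` for every admissible nearest-neighbour list. -/
def twoSidedProb (d : ℕ) (x : Zd d) (m l : ℕ) (η : Traj d) : ℝ :=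
  if η.length = m + l + 1 ∧ η.Chain' IsNN ∧ η[m]? = some x then
    (1 / (2 * (d : ℝ))) ^ (m + l) else 0

/-- The `ℓ^∞`-diameter of the range of `η` is at most `R`. -/
def DiamLE {d : ℕ} (η : Traj d) (R : ℝ) : Prop :=
  ∀ a ∈ η, ∀ b ∈ η, ∀ i, |((a i - b i : ℤ) : ℝ)| ≤ R

/-- `P^x[X[-m,-1] ∩ A = ∅]`: the probability that an `m`-step walk from `x`
avoids `A` at all positive times, written combinatorially. -/
def backAvoidProb (d : ℕ) (A : Set (Zd d)) (x : Zd d) (m : ℕ) : ℝ :=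
  ∑' w : Traj d,
    if w.length = m + 1 ∧ w.Chain' IsNN ∧ w[0]? = some x ∧
        (∀ i : ℕ, 0 < i → ∀ y, w[i]? = some y → y ∉ A) then
      (1 / (2 * (d : ℝ))) ^ m else 0

/-- `μ(x,m,l;A)({η}) = P^x[X[-m,l] = η | X[-m,-1] ∩ A = ∅]`. -/
def condTwoSidedProb (d : ℕ) (A : Set (Zd d)) (x : Zd d) (m l : ℕ) (η : Traj d) : ℝ :=
  (if ∀ i < m, ∀ y, η[i]? = some y → y ∉ A then twoSidedProb d x m l η else 0) /
    backAvoidProb d A x m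

/-- `π_A({η}) = Σ_{x∈A} Σ_{m,l} (ρ(m+l)/(μ₁(ρ)+1))·P^x[H̃_A > m]·μ(x,m,l;A)({η})`. -/
def piA (d : ℕ) (P : Zd d → Measure (ℕ → Zd d)) (ρ : ℕ → ℝ) (A : Finset (Zd d))
    (η : Traj d) : ℝ :=
  ∑ x ∈ A, ∑' m : ℕ, ∑' l : ℕ,
    ρ (m + l) / (mu 1 ρ + 1) * (P x (NoReturnUpTo (↑A) (m : ℝ))).toReal *
      condTwoSidedProb d (↑A) x m l η

/-- The sub-configuration of trajectories meeting `A`, i.e. `𝒳[A]`. -/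
def restrictConfig {d : ℕ} (A : Finset (Zd d)) (ω : Config d) : Config d :=
  fun η => if hits η (↑A) then ω η else 0

/-! ### Products and geometric laws -/

/-- The geometric measure `Geo(1/(T+1))` on `ℕ`. -/
def geoMeasure (T : ℕ) : Measure ℕ :=
  Measure.sum fun k : ℕ => (ENNReal.ofReal (geo (1 / ((T : ℝ) + 1)) k)) • Measure.dirac k

/-- `Q` is the product (independent coupling) of `μ` and `ν`. -/
def IsProdOf {α β : Type*} [MeasurableSpace α] [MeasurableSpace β]
    (Q : Measure (α × β)) (μ : Measure α) (ν : Measure β) : Prop :=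
  IsProbabilityMeasure Q ∧
    ∀ (A : Set α) (B : Set β), MeasurableSet A → MeasurableSet B → Q (A ×ˢ B) = μ A * ν B

/-! ### Coarse graining quantities -/

/-- The constant `c = 0.01`. -/
def cConst : ℝ := 0.01

/-- `R_n = ⌊√(μ₁(ρ_n))⌋`. -/
def Rn (ρ : ℕ → ℕ → ℝ) (n : ℕ) : ℕ := ⌊Real.sqrt (mu 1 (ρ n))⌋₊

/-- The mesoscopic scale `L_n`. -/
def Ln (d : ℕ) (ρ : ℕ → ℕ → ℝ) (n : ℕ) : ℝ :=
  if d = 4 then (Rn ρ n : ℝ) * (Real.log (Rn ρ n)) ^ (-cConst)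
  else (Rn ρ n : ℝ) ^ ((2 + cConst) / ((d : ℝ) - 2))

/-- The slowly growing factor `I_n`. -/
def In (d : ℕ) (ρ : ℕ → ℕ → ℝ) (n : ℕ) : ℝ :=
  if d = 4 then (Real.log (Rn ρ n)) ^ cConst else (Rn ρ n : ℝ) ^ cConst

/-- The scale `T'_n`. -/
def Tn' (d : ℕ) (ρ : ℕ → ℕ → ℝ) (n : ℕ) : ℕ :=
  if d = 4 then ⌊(Rn ρ n : ℝ) ^ (2 : ℕ) / Real.log (mu 1 (ρ n))⌋₊
  else ⌊(Rn ρ n : ℝ) ^ ((2 : ℝ) - cConst / 4)⌋₊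

/-- The scale `l_n`. -/
def lnPar (d : ℕ) (ρ : ℕ → ℕ → ℝ) (n : ℕ) : ℕ :=
  if d = 4 then ⌊(Rn ρ n : ℝ) * (Real.log (Rn ρ n)) ^ (-(2 * cConst))⌋₊
  else ⌊(Rn ρ n : ℝ) ^ ((1 : ℝ) - cConst / 4)⌋₊

/-- The scale `t_n`. -/
def tnPar (d : ℕ) (ρ : ℕ → ℕ → ℝ) (n : ℕ) : ℕ :=
  if d = 4 then ⌊(Rn ρ n : ℝ) ^ (2 : ℕ) / (Real.log (Rn ρ n)) ^ (10 : ℕ)⌋₊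
  else ⌊(Rn ρ n : ℝ) ^ ((2 : ℝ) - cConst)⌋₊

/-- `y` is within `ℓ^∞`-distance `r` of `z`. -/
def InBall {d : ℕ} (y z : Zd d) (r : ℝ) : Prop := ∀ i, |((y i - z i : ℤ) : ℝ)| ≤ r

/-- The `ℓ^∞` `r`-neighbourhood `B(A,r)`. -/
def nbhd {d : ℕ} (A : Set (Zd d)) (r : ℝ) : Set (Zd d) := {y | ∃ z ∈ A, InBall y z r}

/-- The sub-path `η[a, b]` of a trajectory. -/
def segment {d : ℕ} (η : Traj d) (a b : ℕ) : Traj d := (η.drop a).take (b - a + 1)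

/-- `η` is a typical trajectory (the event `𝒯_n = ℰ₁ ∩ ℰ₂ ∩ ℰ₃ ∩ ℰ₄`). -/
def Typical (d : ℕ) (P : Zd d → Measure (ℕ → Zd d)) (εd : ℝ) (ρ : ℕ → ℕ → ℝ)
    (kk KK M θ1 : ℝ) (n : ℕ) (η : Traj d) : Prop :=
  ValidTraj η ∧
  -- ℰ₁
  (kk * (Rn ρ n : ℝ) ^ 2 ≤ (len η : ℝ) ∧ (len η : ℝ) ≤ KK * (Rn ρ n : ℝ) ^ 2 ∧
    ∀ y ∈ η, InBall y η.headI (M * (Rn ρ n : ℝ))) ∧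
  -- ℰ₂
  (if d = 4 then
    (1 - θ1 ^ 2) * (Real.pi ^ 2 / 8) * (len η : ℝ) / Real.log (mu 1 (ρ n)) <
        capacity P η.toFinset ∧
      capTrunc P η.toFinset ((Rn ρ n : ℝ) ^ 2) <
        (1 + θ1 ^ 2) * (Real.pi ^ 2 / 8) * (len η : ℝ) / Real.log (mu 1 (ρ n))
  else
    (1 - θ1 ^ 2) * εd * (len η : ℝ) < capacity P η.toFinset ∧
      capacity P η.toFinset < (1 + θ1 ^ 2) * εd * (len η : ℝ)) ∧
  -- ℰ₃
  ((Set.ncard (nbhd (rangeSet η) (Ln d ρ n)) : ℝ) <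
    (Rn ρ n : ℝ) ^ 2 * (Ln d ρ n) ^ (d - 2) * (In d ρ n) ^ ((1 : ℝ) / 3)) ∧
  -- ℰ₄
  (∀ j : ℕ, j * Tn' d ρ n ≤ len η →
    if d = 4 then
      capacity P (segment η (j * Tn' d ρ n) (min ((j + 1) * Tn' d ρ n) (len η))).toFinset ≤
          (1 + θ1 ^ 2) * (Real.pi ^ 2 / 8) * (Tn' d ρ n : ℝ) / Real.log (mu 1 (ρ n)) ∧
        ∀ a ∈ segment η (j * Tn' d ρ n) (min ((j + 1) * Tn' d ρ n) (len η)),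
          ∀ b ∈ segment η (j * Tn' d ρ n) (min ((j + 1) * Tn' d ρ n) (len η)),
            ∀ i, |((a i - b i : ℤ) : ℝ)| <
              (1 / 2) * Real.sqrt (len η : ℝ) * (Real.log (mu 1 (ρ n))) ^ (-cConst)
    else
      capacity P (segment η (j * Tn' d ρ n) (min ((j + 1) * Tn' d ρ n) (len η))).toFinset ≤
        (1 + θ1 ^ 2) * εd * (Tn' d ρ n : ℝ))

/-- `x` belongs to the `*`-proper part `η̂` of the trajectory `η`. -/
def ProperStar (d : ℕ) (P : Zd d → Measure (ℕ → Zd d)) (ρ : ℕ → ℕ → ℝ)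
    (θ1 θ2 : ℝ) (n : ℕ) (η : Traj d) (x : Zd d) : Prop :=
  x ∈ rangeSet η ∧
    (if d = 4 then
      θ2 / Real.log (mu 1 (ρ n)) ≤ equil P (rangeSet η) x ∧
        (P x (NoReturnUpTo (rangeSet η)
            ((Rn ρ n : ℝ) ^ 2 / (Real.log (Rn ρ n)) ^ (10 : ℕ)))).toReal ≤
          (1 + θ1) * equil P (rangeSet η) x
    else θ2 ≤ equil P (rangeSet η) x)

/-- Expectations of functions of an `ℕ`-valued random variable as sums against its law. -/
lemma hasSum_law {Ω : Type*} [MeasurableSpace Ω] (μ : Measure Ω) [IsProbabilityMeasure μ]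
    (X : Ω → ℕ) (hX : Measurable X) (f : ℕ → ℝ) (hf : Integrable (fun ω => f (X ω)) μ) :
    HasSum (fun k => f k * (μ {ω | X ω = k}).toReal) (∫ ω, f (X ω) ∂μ) := by
  have hm : ∀ k, MeasurableSet {ω | X ω = k} := fun k => hX (measurableSet_singleton k)
  have hU : (⋃ k, {ω | X ω = k}) = Set.univ := by ext ω; simp
  have h := hasSum_integral_iUnion (μ := μ) (f := fun ω => f (X ω)) hm
    (by
      intro i j hij
      refine Set.disjoint_left.2 ?_
      intro ω h1 h2
      exact hij (h1.symm.trans h2)) hf.integrableOn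
  rw [hU, setIntegral_univ] at h
  convert! h using 2 with k
  have : ∫ ω in {ω | X ω = k}, f (X ω) ∂μ = ∫ ω in {ω | X ω = k}, f k ∂μ := by
    refine setIntegral_congr_fun (hm k) ?_
    intro ω hω
    have : X ω = k := hω
    simp [this]
  rw [this, setIntegral_const, smul_eq_mul, mul_comm]
  rfl

/-- The tail appearing in the definition of an appropriate family. -/
lemma tail_antitone (ρ : ℕ → ℝ) (hρ : IsDist ρ)
    (hs : Summable fun l : ℕ => (l : ℝ) ^ 2 * ρ l) {C C' : ℝ} (h : C ≤ C') :
    (∑' L : ℕ, if C' * mu 1 ρ ≤ (L : ℝ) then (L : ℝ) ^ 2 * ρ L / mu 2 ρ else 0) ≤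
    (∑' L : ℕ, if C * mu 1 ρ ≤ (L : ℝ) then (L : ℝ) ^ 2 * ρ L / mu 2 ρ else 0) := by
  have hmu1 : 0 ≤ mu 1 ρ := tsum_nonneg fun l => mul_nonneg (by positivity) (hρ.1 l)
  have hmu2 : 0 ≤ mu 2 ρ := tsum_nonneg fun l => mul_nonneg (by positivity) (hρ.1 l)
  have h0 : ∀ L : ℕ, 0 ≤ (L : ℝ) ^ 2 * ρ L / mu 2 ρ := fun L =>
    div_nonneg (mul_nonneg (by positivity) (hρ.1 L)) hmu2
  have key : ∀ D : ℝ, Summable fun L : ℕ =>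
      if D * mu 1 ρ ≤ (L : ℝ) then (L : ℝ) ^ 2 * ρ L / mu 2 ρ else 0 := by
    intro D
    refine Summable.of_nonneg_of_le (fun L => ?_) (fun L => ?_) (hs.div_const (mu 2 ρ))
    · split_ifs
      exacts [h0 L, le_rfl]
    · split_ifs
      exacts [le_rfl, h0 L]
  refine (key C').tsum_le_tsum (fun L => ?_) (key C)
  by_cases h1 : C' * mu 1 ρ ≤ (L : ℝ)
  · have h2 : C * mu 1 ρ ≤ (L : ℝ) := (mul_le_mul_of_nonneg_right h hmu1).trans h1
    rw [if_pos h1, if_pos h2]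
  · rw [if_neg h1]
    split_ifs
    exacts [h0 L, le_rfl]

/-- For a single distribution the tail is eventually small. -/
lemma tail_single (ρ : ℕ → ℝ) (hρ : IsDist ρ)
    (hs : Summable fun l : ℕ => (l : ℝ) ^ 2 * ρ l) (ε : ℝ) (hε : 0 < ε) :
    ∃ C : ℝ,
    (∑' L : ℕ, if C * mu 1 ρ ≤ (L : ℝ) then (L : ℝ) ^ 2 * ρ L / mu 2 ρ else 0) ≤ ε := by
  have hmu2 : 0 ≤ mu 2 ρ := tsum_nonneg fun l => mul_nonneg (by positivity) (hρ.1 l)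
  have h0 : ∀ L : ℕ, 0 ≤ (L : ℝ) ^ 2 * ρ L / mu 2 ρ := fun L =>
    div_nonneg (mul_nonneg (by positivity) (hρ.1 L)) hmu2
  have hs1 : Summable fun l : ℕ => (l : ℝ) ^ 1 * ρ l := by
    refine Summable.of_nonneg_of_le (fun L => mul_nonneg (by positivity) (hρ.1 L))
      (fun L => mul_le_mul_of_nonneg_right ?_ (hρ.1 L)) hs
    have : L ^ 1 ≤ L ^ 2 := by
      rcases Nat.eq_zero_or_pos L with h | h
      · simp [h]
      · exact Nat.pow_le_pow_right h (by norm_num)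
    exact_mod_cast this
  have ht : Tendsto (fun C : ℝ =>
      ∑' L : ℕ, if C * mu 1 ρ ≤ (L : ℝ) then (L : ℝ) ^ 2 * ρ L / mu 2 ρ else 0) atTop
      (𝓝 (∑' _ : ℕ, (0 : ℝ))) := by
    refine tendsto_tsum_of_dominated_convergence (hs.div_const (mu 2 ρ)) (fun L => ?_)
      (Eventually.of_forall fun C L => ?_)
    · by_cases hz : (L : ℝ) ^ 1 * ρ L = 0
      · have : (L : ℝ) ^ 2 * ρ L = 0 := by
          rw [pow_one] at hz
          rw [pow_two, mul_assoc, hz, mul_zero]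
        simp [this]
      · have hp : 0 < (L : ℝ) ^ 1 * ρ L :=
          lt_of_le_of_ne (mul_nonneg (by positivity) (hρ.1 L)) (Ne.symm hz)
        have hmu1 : 0 < mu 1 ρ := hp.trans_le
          (hs1.le_tsum L fun j _ => mul_nonneg (by positivity) (hρ.1 j))
        refine tendsto_const_nhds.congr' ?_
        filter_upwards [eventually_gt_atTop ((L : ℝ) / mu 1 ρ)] with C hC
        rw [if_neg]
        rw [not_le]
        exact (div_lt_iff₀ hmu1).1 hC
    · rw [Real.norm_eq_abs]
      split_ifs
      · rw [abs_of_nonneg (h0 L)]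
      · simpa using h0 L
  rw [tsum_zero] at ht
  obtain ⟨C, hC⟩ := (ht.eventually (gt_mem_nhds hε)).exists
  exact ⟨C, hC.le⟩

/-- It is enough to control the tails for all large `n`. -/
lemma appropriate_of_eventually (ρ : ℕ → ℕ → ℝ) (h1 : ∀ n, IsDist (ρ n))
    (h2 : ∀ n, Summable fun l : ℕ => (l : ℝ) ^ 2 * ρ n l)
    (h3 : Tendsto (fun n => mu 1 (ρ n)) atTop atTop)
    (h4 : ∀ ε : ℝ, 0 < ε → ∃ C : ℝ, ∀ᶠ n in atTop,
      (∑' L : ℕ, if C * mu 1 (ρ n) ≤ (L : ℝ) then (L : ℝ) ^ 2 * ρ n L / mu 2 (ρ n) else 0)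
        ≤ ε) : Appropriate ρ := by
  refine ⟨h1, h2, h3, fun ε hε => ?_⟩
  obtain ⟨C, hC⟩ := h4 ε hε
  obtain ⟨N, hN⟩ := eventually_atTop.1 hC
  choose D hD using fun n => tail_single (ρ n) (h1 n) (h2 n) ε hε
  obtain ⟨M, hM⟩ := ((Finset.range N).image D).bddAbove
  refine ⟨max C M, fun n => ?_⟩
  rcases le_or_gt N n with h | h
  · exact (tail_antitone (ρ n) (h1 n) (h2 n) (le_max_left _ _)).trans (hN n h)
  · have : D n ≤ M := hM (by
      simp only [Finset.coe_image, Set.mem_image]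
      exact ⟨n, by simpa using h, rfl⟩)
    exact (tail_antitone (ρ n) (h1 n) (h2 n) (this.trans (le_max_right _ _))).trans (hD n)

lemma appropriate_dirac : Appropriate (fun n k => if k = n then (1 : ℝ) else 0) := by
  have hmu : ∀ n : ℕ, mu 1 (fun k => if k = n then (1 : ℝ) else 0) = n := by
    intro n
    unfold mu
    rw [tsum_eq_single n]
    · simp
    · intro b hb
      simp [hb]
  refine ⟨fun n => ⟨fun k => ?_, hasSum_ite_eq n 1⟩, fun n => ?_, ?_, fun ε hε => ⟨2, fun n => ?_⟩⟩
  · dsimp only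
    split_ifs <;> norm_num
  · refine summable_of_ne_finset_zero (s := {n}) fun b hb => ?_
    have : b ≠ n := by simpa using hb
    simp [this]
  · simp only [hmu]
    exact tendsto_natCast_atTop_atTop
  · refine le_trans (le_of_eq ?_) hε.le
    refine (tsum_congr fun L => ?_).trans (tsum_zero (α := ℝ) (β := ℕ))
    rw [hmu]
    by_cases h : L = n
    · subst h
      rcases Nat.eq_zero_or_pos L with h0 | h0
      · simp [h0]
      · have : (0 : ℝ) < L := by exact_mod_cast h0
        rw [if_neg]
        linarith
    · simp [h]

lemma appropriate_geo : Appropriate (fun n k => geo (1 / ((n : ℝ) + 1)) k) := by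
  have hbase : ∀ (k n : ℕ), HasSum
      (fun L : ℕ => ((L + k).choose k : ℝ) * geo (1 / ((n : ℝ) + 1)) L) (((n : ℝ) + 1) ^ k) := by
    intro k n
    have hn : (0 : ℝ) < (n : ℝ) + 1 := by positivity
    have hlam : 1 - 1 / ((n : ℝ) + 1) = n / (n + 1) := by field_simp; ring
    have hr : ‖(1 - 1 / ((n : ℝ) + 1) : ℝ)‖ < 1 := by
      rw [hlam, Real.norm_of_nonneg (by positivity), div_lt_one hn]
      linarith
    have h := (hasSum_choose_mul_geometric_of_norm_lt_one k hr).mul_left (1 / ((n : ℝ) + 1))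
    convert! h using 1
    · ext L
      unfold geo
      ring
    · rw [sub_sub_cancel, div_pow, one_pow, one_div_one_div, pow_succ]
      field_simp
  have h0 : ∀ n : ℕ, HasSum (fun L : ℕ => geo (1 / ((n : ℝ) + 1)) L) 1 := by
    intro n
    simpa using hbase 0 n
  have h1' : ∀ n : ℕ, HasSum (fun L : ℕ => (L : ℝ) ^ 1 * geo (1 / ((n : ℝ) + 1)) L) n := by
    intro n
    convert! (hbase 1 n).sub (h0 n) using 1
    · ext L
      simp
      ring
    · ring
  have hc2 : ∀ L : ℕ, ((L + 2).choose 2 : ℝ) = ((L : ℝ) + 1) * (L + 2) / 2 := by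
    intro L
    rw [Nat.cast_choose_two]
    push_cast
    ring
  have hc3 : ∀ L : ℕ, ((L + 3).choose 3 : ℝ) = ((L : ℝ) + 1) * (L + 2) * (L + 3) / 6 := by
    intro L
    have := Nat.descFactorial_eq_factorial_mul_choose (L + 3) 3
    have h2 : (L + 3).descFactorial 3 = (L + 1) * (L + 2) * (L + 3) := by
      simp [Nat.descFactorial]
      ring
    rw [h2] at this
    have h3 : (((L + 1) * (L + 2) * (L + 3) : ℕ) : ℝ) = ((3).factorial * (L + 3).choose 3 : ℕ) := by
      exact_mod_cast this
    simp [Nat.factorial] at h3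
    linarith
  have h2' : ∀ n : ℕ, HasSum (fun L : ℕ => (L : ℝ) ^ 2 * geo (1 / ((n : ℝ) + 1)) L)
      (2 * (n : ℝ) ^ 2 + n) := by
    intro n
    convert! (((hbase 2 n).mul_left 2).sub ((h1' n).mul_left 3)).sub ((h0 n).mul_left 2) using 1
    · ext L
      rw [hc2]
      ring
    · ring
  have hnn : ∀ n k : ℕ, 0 ≤ geo (1 / ((n : ℝ) + 1)) k := by
    intro n k
    have hlam : 1 - 1 / ((n : ℝ) + 1) = n / (n + 1) := by field_simp; ring
    unfold geo
    rw [hlam]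
    positivity
  have hm1 : ∀ n : ℕ, mu 1 (fun k => geo (1 / ((n : ℝ) + 1)) k) = n := fun n => (h1' n).tsum_eq
  have hm2 : ∀ n : ℕ, mu 2 (fun k => geo (1 / ((n : ℝ) + 1)) k) = 2 * (n : ℝ) ^ 2 + n :=
    fun n => (h2' n).tsum_eq
  refine appropriate_of_eventually _ (fun n => ⟨hnn n, h0 n⟩) (fun n => (h2' n).summable) ?_ ?_
  · simp only [hm1]
    exact tendsto_natCast_atTop_atTop
  · intro ε hε
    refine ⟨24 / ε, ?_⟩
    filter_upwards [eventually_ge_atTop 1] with n hn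
    have hn1 : (1 : ℝ) ≤ n := by exact_mod_cast hn
    simp only [hm1, hm2]
    have hden : 0 < 2 * (n : ℝ) ^ 2 + n := by positivity
    have hb := (hbase 3 n).mul_left (6 * (ε / (24 * n)) / (2 * (n : ℝ) ^ 2 + n))
    have hterm : ∀ L : ℕ, (if 24 / ε * n ≤ (L : ℝ) then
        (L : ℝ) ^ 2 * geo (1 / ((n : ℝ) + 1)) L / (2 * (n : ℝ) ^ 2 + n) else 0) ≤
        6 * (ε / (24 * n)) / (2 * (n : ℝ) ^ 2 + n) *
          (((L + 3).choose 3 : ℝ) * geo (1 / ((n : ℝ) + 1)) L) := by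
      intro L
      have hg := hnn n L
      split_ifs with h
      · have h1 : 1 ≤ ε / (24 * n) * L := by
          rw [div_mul_eq_mul_div, le_div_iff₀ (by positivity)]
          have := mul_le_mul_of_nonneg_left h hε.le
          have e : ε * (24 / ε * n) = 24 * n := by field_simp
          linarith
        rw [hc3]
        have hL : (0 : ℝ) ≤ L := by positivity
        have hq : 0 ≤ ε / (24 * n) := by positivity
        have h2 : (L : ℝ) ^ 2 ≤ ε / (24 * n) * ((L + 1) * (L + 2) * (L + 3)) := by
          calc (L : ℝ) ^ 2 ≤ (ε / (24 * n) * L) * (L : ℝ) ^ 2 :=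
                le_mul_of_one_le_left (by positivity) h1
            _ = ε / (24 * n) * (L : ℝ) ^ 3 := by ring
            _ ≤ _ := by
                refine mul_le_mul_of_nonneg_left ?_ hq
                nlinarith [mul_nonneg hL hL]
        have h3 : (L : ℝ) ^ 2 * geo (1 / ((n : ℝ) + 1)) L / (2 * (n : ℝ) ^ 2 + n) ≤
            ε / (24 * n) * ((L + 1) * (L + 2) * (L + 3)) * geo (1 / ((n : ℝ) + 1)) L /
              (2 * (n : ℝ) ^ 2 + n) := by gcongr
        refine h3.trans (le_of_eq ?_)
        ring
      · positivity
    have hs : Summable fun L : ℕ => (if 24 / ε * n ≤ (L : ℝ) then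
        (L : ℝ) ^ 2 * geo (1 / ((n : ℝ) + 1)) L / (2 * (n : ℝ) ^ 2 + n) else 0) := by
      refine Summable.of_nonneg_of_le (fun L => ?_) hterm hb.summable
      have hg := hnn n L
      split_ifs <;> positivity
    refine (hs.tsum_le_tsum hterm hb.summable).trans ?_
    rw [hb.tsum_eq]
    rw [div_mul_eq_mul_div, div_le_iff₀ hden]
    have e : 6 * (ε / (24 * n)) * ((n : ℝ) + 1) ^ 3 = ε * (((n : ℝ) + 1) ^ 3 / (4 * n)) := by
      field_simp
      ring
    rw [e]
    refine mul_le_mul_of_nonneg_left ?_ hε.le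
    rw [div_le_iff₀ (by positivity)]
    nlinarith [mul_nonneg (sub_nonneg.2 hn1) (sub_nonneg.2 hn1),
      mul_nonneg (mul_nonneg (sub_nonneg.2 hn1) (sub_nonneg.2 hn1)) (sub_nonneg.2 hn1)]

lemma appropriate_floor
    {Ω : Type*} [MeasurableSpace Ω] (μ : Measure Ω) (hμ : IsProbabilityMeasure μ)
    (ξ : Ω → ℝ) (hmeas : Measurable ξ) (hpos : ∀ ω, 0 < ξ ω)
    (hL2 : Integrable (fun ω => ξ ω ^ 2) μ)
    (l : ℕ → ℝ) (hl : ∀ n, 0 < l n) (hltop : Tendsto l atTop atTop) :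
    Appropriate (fun n k => (μ {ω | ⌊l n * ξ ω⌋ = (k : ℤ)}).toReal) := by
  set X : ℕ → Ω → ℕ := fun n ω => ⌊l n * ξ ω⌋₊ with hXdef
  have hX : ∀ n, Measurable (X n) := fun n => Nat.measurable_floor.comp (hmeas.const_mul (l n))
  have hset : ∀ n k : ℕ, {ω | ⌊l n * ξ ω⌋ = (k : ℤ)} = {ω | X n ω = k} := by
    intro n k
    ext ω
    have h0 : 0 ≤ l n * ξ ω := (mul_pos (hl n) (hpos ω)).le
    have : ((X n ω : ℕ) : ℤ) = ⌊l n * ξ ω⌋ := Int.natCast_floor_eq_floor h0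
    simp only [Set.mem_setOf_eq]
    rw [← this]
    exact Nat.cast_inj
  simp only [hset]
  have hle : ∀ n ω, (X n ω : ℝ) ≤ l n * ξ ω := fun n ω =>
    Nat.floor_le (mul_pos (hl n) (hpos ω)).le
  have hge : ∀ n ω, l n * ξ ω - 1 ≤ (X n ω : ℝ) := fun n ω => (Nat.sub_one_lt_floor _).le
  have hXm : ∀ n, Measurable (fun ω => (X n ω : ℝ)) := fun n =>
    measurable_from_top.comp (hX n)
  have hsqle : ∀ n ω, (X n ω : ℝ) ^ 2 ≤ l n ^ 2 * ξ ω ^ 2 := by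
    intro n ω
    rw [← mul_pow]
    exact pow_le_pow_left₀ (Nat.cast_nonneg _) (hle n ω) 2
  have hξ1 : Integrable ξ μ := by
    refine (hL2.add (integrable_const (1 : ℝ))).mono' hmeas.aestronglyMeasurable
      (Eventually.of_forall fun ω => ?_)
    rw [Real.norm_of_nonneg (hpos ω).le]
    simp only [Pi.add_apply]
    nlinarith [sq_nonneg (ξ ω - 1), hpos ω]
  have hI1 : ∀ n, Integrable (fun ω => (X n ω : ℝ)) μ := by
    intro n
    refine (hξ1.const_mul (l n)).mono' (hXm n).aestronglyMeasurable
      (Eventually.of_forall fun ω => ?_)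
    rw [Real.norm_of_nonneg (Nat.cast_nonneg _)]
    exact hle n ω
  have hI2 : ∀ n, Integrable (fun ω => (X n ω : ℝ) ^ 2) μ := by
    intro n
    refine (hL2.const_mul (l n ^ 2)).mono' ((hXm n).pow_const 2).aestronglyMeasurable
      (Eventually.of_forall fun ω => ?_)
    rw [Real.norm_of_nonneg (by positivity)]
    exact hsqle n ω
  have hS0 : ∀ n, HasSum (fun k => (μ {ω | X n ω = k}).toReal) 1 := by
    intro n
    simpa using hasSum_law μ (X n) (hX n) (fun _ => 1) (integrable_const _)
  have hS1 : ∀ n, mu 1 (fun k => (μ {ω | X n ω = k}).toReal) = ∫ ω, (X n ω : ℝ) ∂μ := by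
    intro n
    have := (hasSum_law μ (X n) (hX n) (fun k => (k : ℝ)) (hI1 n)).tsum_eq
    simpa [mu] using this
  have hS2 : ∀ n, HasSum (fun k : ℕ => (k : ℝ) ^ 2 * (μ {ω | X n ω = k}).toReal)
      (∫ ω, (X n ω : ℝ) ^ 2 ∂μ) := fun n =>
    hasSum_law μ (X n) (hX n) (fun k => (k : ℝ) ^ 2) (hI2 n)
  have hM2 : ∀ n, mu 2 (fun k => (μ {ω | X n ω = k}).toReal) = ∫ ω, (X n ω : ℝ) ^ 2 ∂μ :=
    fun n => (hS2 n).tsum_eq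
  set m : ℝ := ∫ ω, ξ ω ∂μ with hm
  have hmpos : 0 < m := by
    rw [hm, integral_pos_iff_support_of_nonneg (fun ω => (hpos ω).le) hξ1]
    have : Function.support ξ = Set.univ := by
      ext ω
      simp [(hpos ω).ne']
    rw [this]
    simp
  have hlow : ∀ n, l n * m - 1 ≤ ∫ ω, (X n ω : ℝ) ∂μ := by
    intro n
    have h : ∫ ω, (l n * ξ ω - 1) ∂μ ≤ ∫ ω, (X n ω : ℝ) ∂μ :=
      integral_mono ((hξ1.const_mul (l n)).sub (integrable_const (1 : ℝ))) (hI1 n)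
        (fun ω => hge n ω)
    have e : ∫ ω, (l n * ξ ω - 1) ∂μ = l n * m - 1 := by
      rw [integral_sub (hξ1.const_mul (l n)) (integrable_const (1 : ℝ)), integral_const_mul]
      simp [hm]
    rw [← e]
    exact h
  have hlm : Tendsto (fun n => l n * m) atTop atTop := hltop.atTop_mul_const hmpos
  refine appropriate_of_eventually _ (fun n => ⟨fun k => ENNReal.toReal_nonneg, hS0 n⟩)
    (fun n => (hS2 n).summable) ?_ ?_
  · simp only [hS1]
    exact tendsto_atTop_mono hlow (tendsto_atTop_add_const_right _ (-1) hlm)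
  · intro ε hε
    have htail : Tendsto (fun C : ℕ => ∫ ω, (if (C : ℝ) * (m / 2) ≤ ξ ω then ξ ω ^ 2 else 0) ∂μ)
        atTop (𝓝 (∫ _ : Ω, (0 : ℝ) ∂μ)) := by
      refine tendsto_integral_of_dominated_convergence (fun ω => ξ ω ^ 2) (fun C => ?_) hL2
        (fun C => Eventually.of_forall fun ω => ?_) (Eventually.of_forall fun ω => ?_)
      · exact (Measurable.ite (measurableSet_le measurable_const hmeas) (hmeas.pow_const 2)
          measurable_const).aestronglyMeasurable
      · split_ifs
        · rw [Real.norm_of_nonneg (by positivity)]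
        · simp only [norm_zero]
          positivity
      · refine tendsto_const_nhds.congr' ?_
        have : Tendsto (fun C : ℕ => (C : ℝ) * (m / 2)) atTop atTop :=
          tendsto_natCast_atTop_atTop.atTop_mul_const (by positivity)
        filter_upwards [this.eventually_gt_atTop (ξ ω)] with C hC
        rw [if_neg (not_le.2 hC)]
    rw [integral_zero] at htail
    obtain ⟨C, hC⟩ := (htail.eventually
      (gt_mem_nhds (show 0 < ε * (m / 2) ^ 2 by positivity))).exists
    refine ⟨C, ?_⟩
    filter_upwards [hlm.eventually_ge_atTop 2] with n hn
    simp only [hS1, hM2]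
    set a : ℝ := ∫ ω, (X n ω : ℝ) ∂μ with ha
    set b : ℝ := ∫ ω, (X n ω : ℝ) ^ 2 ∂μ with hb
    have ha1 : l n * (m / 2) ≤ a := by
      have := hlow n
      linarith
    have hlp := hl n
    have hb1 : a ^ 2 ≤ b := by
      have h : ∫ ω, (2 * a * (X n ω : ℝ) - a ^ 2) ∂μ ≤ b :=
        integral_mono (((hI1 n).const_mul (2 * a)).sub (integrable_const (a ^ 2))) (hI2 n)
          (fun ω => by
            simp only
            nlinarith [sq_nonneg ((X n ω : ℝ) - a)])
      rw [integral_sub ((hI1 n).const_mul (2 * a)) (integrable_const (a ^ 2)),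
        integral_const_mul] at h
      simp only [integral_const, probReal_univ, one_smul, ← ha] at h
      nlinarith
    have hb2 : (l n * (m / 2)) ^ 2 ≤ b :=
      (pow_le_pow_left₀ (by positivity) ha1 2).trans hb1
    have hbpos : 0 < b := lt_of_lt_of_le (by positivity) hb2
    have hfm : Measurable (fun ω => if (C : ℝ) * a ≤ (X n ω : ℝ) then (X n ω : ℝ) ^ 2 / b else 0) :=
      Measurable.ite (measurableSet_le measurable_const (hXm n)) (((hXm n).pow_const 2).div_const b)
          measurable_const
    have hfi : Integrable
        (fun ω => if (C : ℝ) * a ≤ (X n ω : ℝ) then (X n ω : ℝ) ^ 2 / b else 0) μ := by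
      refine ((hI2 n).div_const b).mono' hfm.aestronglyMeasurable
        (Eventually.of_forall fun ω => ?_)
      split_ifs
      · rw [Real.norm_of_nonneg (by positivity)]
      · simp only [norm_zero]
        positivity
    have hsum := (hasSum_law μ (X n) (hX n)
      (fun k : ℕ => if (C : ℝ) * a ≤ (k : ℝ) then (k : ℝ) ^ 2 / b else 0) hfi).tsum_eq
    have e : (∑' L : ℕ, if (C : ℝ) * a ≤ (L : ℝ) then
        (L : ℝ) ^ 2 * (μ {ω | X n ω = L}).toReal / b else 0) =
        ∫ ω, (if (C : ℝ) * a ≤ (X n ω : ℝ) then (X n ω : ℝ) ^ 2 / b else 0) ∂μ := by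
      rw [← hsum]
      refine tsum_congr fun L => ?_
      split_ifs
      · ring
      · ring
    rw [e]
    have hgi : Integrable (fun ω => if (C : ℝ) * (m / 2) ≤ ξ ω then ξ ω ^ 2 else 0) μ := by
      refine hL2.mono' (Measurable.ite (measurableSet_le measurable_const hmeas)
        (hmeas.pow_const 2) measurable_const).aestronglyMeasurable
        (Eventually.of_forall fun ω => ?_)
      split_ifs
      · rw [Real.norm_of_nonneg (by positivity)]
      · simp only [norm_zero]
        positivity
    have hcmp := integral_mono hfi (hgi.const_mul (l n ^ 2 / b)) (fun ω => by
      simp only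
      by_cases h : (C : ℝ) * a ≤ (X n ω : ℝ)
      · have h' : (C : ℝ) * (m / 2) ≤ ξ ω := by
          have h2 : (C : ℝ) * (l n * (m / 2)) ≤ l n * ξ ω :=
            ((mul_le_mul_of_nonneg_left ha1 (Nat.cast_nonneg C)).trans h).trans (hle n ω)
          have h3 : l n * ((C : ℝ) * (m / 2)) ≤ l n * ξ ω := by linarith
          exact le_of_mul_le_mul_left h3 hlp
        rw [if_pos h, if_pos h', div_mul_eq_mul_div]
        exact div_le_div_of_nonneg_right (hsqle n ω) hbpos.le
      · rw [if_neg h]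
        split_ifs <;> positivity)
    refine hcmp.trans ?_
    rw [integral_const_mul, div_mul_eq_mul_div, div_le_iff₀ hbpos]
    calc _ ≤ l n ^ 2 * (ε * (m / 2) ^ 2) := mul_le_mul_of_nonneg_left hC.le (by positivity)
      _ = ε * (l n * (m / 2)) ^ 2 := by ring
      _ ≤ ε * b := mul_le_mul_of_nonneg_left hb2 hε.le

/-- **Remark 1.2.** If `ξ > 0` has finite second moment and `l(n) → ∞`, then the
laws `ρ_n` of `⌊l(n)·ξ⌋` form an appropriate family; in particular the Dirac family
`(δ_n)` and the geometric family `(Geo(1/(n+1)))` are appropriate. -/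
theorem floor_family_is_appropriate
    {Ω : Type*} [MeasurableSpace Ω] (μ : Measure Ω) (hμ : IsProbabilityMeasure μ)
    (ξ : Ω → ℝ) (hmeas : Measurable ξ) (hpos : ∀ ω, 0 < ξ ω)
    (hL2 : Integrable (fun ω => ξ ω ^ 2) μ)
    (l : ℕ → ℝ) (hl : ∀ n, 0 < l n) (hltop : Tendsto l atTop atTop) :
    Appropriate (fun n k => (μ {ω | ⌊l n * ξ ω⌋ = (k : ℤ)}).toReal) ∧
    Appropriate (fun n k => if k = n then (1 : ℝ) else 0) ∧
    Appropriate (fun n k => geo (1 / ((n : ℝ) + 1)) k) :=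
  ⟨appropriate_floor μ hμ ξ hmeas hpos hL2 l hl hltop, appropriate_dirac, appropriate_geo⟩

end FRIPaper
end
end

section
/- Let d ≥ 4, u > 0, let ρ be a probability distribution on ℕ with finite positive mean, and let A ⊆ ℤ^d be finite. Then the point process 𝒳^{u,ρ}[A], consisting of those trajectories of 𝒳^{u,ρ} whose range intersects A, is a Poisson point process on W with intensity measure u·π_A, where π_A = Σ_{x∈A} Σ_{m,l∈ℕ} (ρ(m+l)/(μ_1(ρ)+1))·P^x[H̃_A > m]·μ(x,m,l;A), and μ(x,m,l;A)(·) = P^x[X[-m,l] ∈ · | X[-m,-1] ∩ A = ∅] is the law of the two-sided path (X_{-m},…,X_l) of a doubly infinite simple random walk with X_0 = x, conditioned on {X_{-m},…,X_{-1}} ∩ A = ∅. -/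
open MeasureTheory ProbabilityTheory Filter Topology
open scoped ENNReal NNReal Classical

noncomputable section

namespace FRIPaper

theorem aux_isNN_symm {d : ℕ} {x y : Zd d} (h : IsNN x y) : IsNN y x := by
  unfold IsNN at *
  rw [← h]
  refine Finset.sum_congr rfl fun i _ => ?_
  omega

theorem aux_chain_iff {d : ℕ} (w : Traj d) (m : ℕ) (hw : w.length = m + 1) :
    w.Chain' IsNN ↔ ∀ t < m, IsNN (w.getD t 0) (w.getD (t + 1) 0) := by
  rw [List.Chain', List.isChain_iff_getElem]
  constructor
  · intro h t ht
    have := h t (by omega)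
    rw [List.getD_eq_getElem w 0 (by omega), List.getD_eq_getElem w 0 (by omega)]
    exact this
  · intro h t ht
    have := h t (by omega)
    rw [List.getD_eq_getElem w 0 (by omega), List.getD_eq_getElem w 0 (by omega)] at this
    exact this

/-- Lists of `m+1` points avoiding `A` at positive times. -/
def auxGood {d : ℕ} (A : Set (Zd d)) (m : ℕ) (w : Traj d) : Prop :=
  w.length = m + 1 ∧ ∀ i : ℕ, 0 < i → ∀ y, w[i]? = some y → y ∉ A

/-- Cylinder of a good list. -/
def auxCyl {d : ℕ} (A : Set (Zd d)) (m : ℕ) (w : Traj d) : Set (ℕ → Zd d) :=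
  if auxGood A m w then {ω | ∀ t ≤ m, ω t = w.getD t 0} else ∅

theorem aux_union {d : ℕ} (A : Set (Zd d)) (m : ℕ) :
    NoReturnUpTo A (m : ℝ) = ⋃ w : Traj d, auxCyl A m w := by
  ext ω
  simp only [Set.mem_iUnion, NoReturnUpTo, Set.mem_setOf_eq, Nat.cast_le]
  constructor
  · intro h
    refine ⟨List.ofFn fun i : Fin (m + 1) => ω i, ?_⟩
    have hg : auxGood A m (List.ofFn fun i : Fin (m + 1) => ω i) := by
      refine ⟨by simp, ?_⟩
      intro i hi y hy
      rw [List.getElem?_eq_some_iff] at hy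
      obtain ⟨hlt, rfl⟩ := hy
      simp only [List.length_ofFn] at hlt
      rw [List.getElem_ofFn]
      exact h i hi (by omega)
    rw [auxCyl, if_pos hg]
    intro t ht
    rw [List.getD_eq_getElem _ _ (by rw [List.length_ofFn]; omega), List.getElem_ofFn]
  · rintro ⟨w, hw⟩ t ht htm
    unfold auxCyl at hw
    split_ifs at hw with hg
    · rw [hw t htm]
      refine hg.2 t ht _ ?_
      have hl := hg.1
      rw [List.getD_eq_getElem w 0 (by omega)]
      exact List.getElem?_eq_getElem _
    · exact hw.elim

theorem aux_disj {d : ℕ} (A : Set (Zd d)) (m : ℕ) :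
    Pairwise (Function.onFun Disjoint (auxCyl (d := d) A m)) := by
  intro v w hvw
  rw [Function.onFun, Set.disjoint_left]
  intro ω hv hw
  unfold auxCyl at hv hw
  split_ifs at hv with h1
  · split_ifs at hw with h2
    · apply hvw
      have l1 := h1.1
      have l2 := h2.1
      refine List.ext_getElem (by omega) fun i hi hi' => ?_
      have e1 := hv i (by omega)
      have e2 := hw i (by omega)
      rw [List.getD_eq_getElem _ 0 (by omega)] at e1 e2
      rw [← e1, ← e2]
    · exact hw
  · exact hv

theorem aux_meas {d : ℕ} (A : Set (Zd d)) (m : ℕ) (w : Traj d) :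
    MeasurableSet (auxCyl A m w) := by
  unfold auxCyl
  split_ifs
  · have : {ω : ℕ → Zd d | ∀ t ≤ m, ω t = w.getD t 0} =
        ⋂ t ∈ Set.Iic m, (fun ω : ℕ → Zd d => ω t) ⁻¹' {w.getD t 0} := by
      ext ω; simp
    rw [this]
    exact MeasurableSet.biInter (Set.to_countable _) fun t _ =>
      measurable_pi_apply t (measurableSet_singleton _)
  · exact MeasurableSet.empty

theorem aux_backAvoid {d : ℕ} (A : Set (Zd d)) (x : Zd d) (m : ℕ)
    (P : Measure (ℕ → Zd d)) (hP : IsSRW d x P) :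
    (P (NoReturnUpTo A (m : ℝ))).toReal = backAvoidProb d A x m := by
  haveI := hP.1
  rw [aux_union, measure_iUnion (aux_disj A m) (aux_meas A m),
    ENNReal.tsum_toReal_eq (fun w => measure_ne_top P _)]
  unfold backAvoidProb
  refine tsum_congr fun w => ?_
  unfold auxCyl
  by_cases hg : auxGood A m w
  · rw [if_pos hg, hP.2 m fun t => w.getD t 0]
    have hl := hg.1
    have h0 : w[0]? = some x ↔ w.getD 0 0 = x := by
      rw [List.getD_eq_getElem w 0 (by omega), List.getElem?_eq_getElem (by omega)]
      simp
    have hiff : (w.length = m + 1 ∧ w.Chain' IsNN ∧ w[0]? = some x ∧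
        (∀ i : ℕ, 0 < i → ∀ y, w[i]? = some y → y ∉ A)) ↔
        (w.getD 0 0 = x ∧ ∀ t < m, IsNN (w.getD t 0) (w.getD (t + 1) 0)) := by
      rw [aux_chain_iff w m hl, h0]
      exact ⟨fun h => ⟨h.2.2.1, h.2.1⟩, fun h => ⟨hl, h.2, h.1, hg.2⟩⟩
    simp only [hiff]
    split_ifs
    · simp
    · simp
  · rw [if_neg hg, if_neg fun h => hg ⟨h.1, h.2.2.2⟩]
    simp

theorem aux_pos {d : ℕ} (A : Set (Zd d)) (x : Zd d) (m l : ℕ)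
    (P : Measure (ℕ → Zd d)) (hP : IsSRW d x P) (η : Traj d)
    (hl : η.length = m + l + 1) (hc : η.Chain' IsNN) (hx : η[m]? = some x)
    (hav : ∀ i < m, ∀ y, η[i]? = some y → y ∉ A) :
    (P (NoReturnUpTo A (m : ℝ))).toReal ≠ 0 := by
  haveI := hP.1
  have hcyl := hP.2 m fun t => η.getD (m - t) 0
  rw [if_pos] at hcyl
  · have hsub : {ω : ℕ → Zd d | ∀ t ≤ m, ω t = η.getD (m - t) 0} ⊆ NoReturnUpTo A (m : ℝ) := by
      intro ω hω t ht htm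
      rw [Nat.cast_le] at htm
      rw [hω t htm]
      refine hav (m - t) (by omega) _ ?_
      rw [List.getD_eq_getElem η 0 (by omega)]
      exact List.getElem?_eq_getElem _
    have hle := measure_mono (μ := P) hsub
    rw [hcyl] at hle
    refine (ENNReal.toReal_pos ?_ (measure_ne_top P _)).ne'
    intro h0
    rw [h0] at hle
    have : (((2 * d : ℕ) : ℝ≥0∞))⁻¹ ^ m ≠ 0 :=
      pow_ne_zero _ (ENNReal.inv_ne_zero.2 (ENNReal.natCast_ne_top _))
    exact this (le_antisymm hle bot_le)
  · refine ⟨?_, fun t ht => ?_⟩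
    · simp [List.getD_eq_getElem?_getD, hx]
    · have h := (aux_chain_iff η (m + l) hl).1 hc (m - (t + 1)) (by omega)
      have e : m - (t + 1) + 1 = m - t := by omega
      rw [e] at h
      exact aux_isNN_symm h

/-- The list avoids `A` before time `m`. -/
def auxAv {d : ℕ} (A : Set (Zd d)) (m : ℕ) (η : Traj d) : Prop :=
  ∀ i < m, ∀ y, η[i]? = some y → y ∉ A

theorem aux_term {d : ℕ} (A : Set (Zd d)) (x : Zd d) (m l : ℕ)
    (P : Measure (ℕ → Zd d)) (hP : IsSRW d x P) (η : Traj d) (c : ℝ) :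
    c * (P (NoReturnUpTo A (m : ℝ))).toReal * condTwoSidedProb d A x m l η =
      if auxAv A m η then c * twoSidedProb d x m l η else 0 := by
  unfold condTwoSidedProb auxAv
  split_ifs with hav
  · unfold twoSidedProb
    split_ifs with h
    · have hp := aux_pos A x m l P hP η h.1 h.2.1 h.2.2 hav
      rw [← aux_backAvoid A x m P hP]
      field_simp
    · simp
  · simp

theorem aux_piA (d : ℕ) (u : ℝ) (ρ : ℕ → ℝ) (Pw : Zd d → Measure (ℕ → Zd d))
    (hPw : IsSRWFamily d Pw) (A : Finset (Zd d)) (η : Traj d) :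
    u * piA d Pw ρ A η = if hits η (↑A) then friIntensity d u ρ η else 0 := by
  unfold piA
  simp only [fun x m l => aux_term (↑A : Set (Zd d)) x m l (Pw x) (hPw x) η]
  by_cases hh : hits η (↑A) ∧ ValidTraj η
  · obtain ⟨hh, hv⟩ := hh
    rw [if_pos hh, friIntensity, if_pos hv]
    have hex : ∃ i : ℕ, ∃ y : Zd d, η[i]? = some y ∧ y ∈ A := by
      obtain ⟨y, hy, hyA⟩ := hh
      obtain ⟨i, hi⟩ := List.mem_iff_getElem?.1 hy
      exact ⟨i, y, hi, hyA⟩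
    obtain ⟨x0, hx0, hx0A⟩ := Nat.find_spec hex
    have hmin : auxAv (↑A : Set (Zd d)) (Nat.find hex) η :=
      fun i hi y hy hyA => Nat.find_min hex hi ⟨y, hy, hyA⟩
    generalize Nat.find hex = m0 at hx0 hmin
    obtain ⟨l0, hl0⟩ : ∃ l0, η.length = m0 + l0 + 1 := by
      obtain ⟨h, -⟩ := List.getElem?_eq_some_iff.1 hx0
      exact ⟨η.length - 1 - m0, by omega⟩
    have hm : ∀ x ∈ A, ∀ m l, m ≠ m0 →
        (if auxAv (↑A : Set (Zd d)) m η then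
          ρ (m + l) / (mu 1 ρ + 1) * twoSidedProb d x m l η else 0) = 0 := by
      intro x hx m l hne
      split_ifs with h
      · rw [twoSidedProb, if_neg, mul_zero]
        rintro ⟨-, -, h3⟩
        rcases lt_or_gt_of_ne hne with hlt | hgt
        · exact hmin m hlt x h3 hx
        · exact h m0 hgt x0 hx0 hx0A
      · rfl
    rw [Finset.sum_eq_single_of_mem x0 hx0A]
    · rw [tsum_eq_single m0, tsum_eq_single l0]
      · rw [if_pos hmin, twoSidedProb, if_pos ⟨hl0, hv.2, hx0⟩]
        have : len η = m0 + l0 := by unfold len; omega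
        rw [this]; ring
      · intro l hl
        rw [if_pos hmin, twoSidedProb, if_neg, mul_zero]
        rintro ⟨h1, -⟩
        omega
      · intro m hne
        simp only [fun l => hm x0 hx0A m l hne, tsum_zero]
    · intro x hx hne
      have : ∀ m l, (if auxAv (↑A : Set (Zd d)) m η then
          ρ (m + l) / (mu 1 ρ + 1) * twoSidedProb d x m l η else 0) = 0 := by
        intro m l
        by_cases hmm : m = m0
        · subst hmm
          rw [if_pos hmin, twoSidedProb, if_neg, mul_zero]
          rintro ⟨-, -, h3⟩
          rw [hx0] at h3
          exact hne (Option.some.inj h3).symm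
        · exact hm x hx m l hmm
      simp only [this, tsum_zero]
  · have hr : (if hits η (↑A) then friIntensity d u ρ η else 0) = 0 := by
      split_ifs with h
      · rw [friIntensity, if_neg fun hv => hh ⟨h, hv⟩]
      · rfl
    rw [hr, Finset.sum_eq_zero, mul_zero]
    intro x hx
    have : ∀ m l, twoSidedProb d x m l η = 0 := by
      intro m l
      rw [twoSidedProb, if_neg]
      rintro ⟨h1, h2, h3⟩
      refine hh ⟨⟨x, List.mem_of_getElem? h3, hx⟩, ?_, h2⟩
      rintro rfl
      simp at h1
    simp [this]

theorem aux_poisson_zero (n : ℕ) : poissonProb 0 n = if n = 0 then 1 else 0 := by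
  unfold poissonProb
  split_ifs with h
  · subst h; simp
  · simp [h]

theorem aux_meas_restrict {d : ℕ} (A : Finset (Zd d)) :
    Measurable (restrictConfig (d := d) A) := by
  refine measurable_pi_lambda _ fun η => ?_
  unfold restrictConfig
  by_cases h : hits η (↑A)
  · simp only [h, if_true]; exact measurable_pi_apply η
  · simp only [h, if_false]; exact measurable_const

/-- **Lemma 2.3 (rerooting).** For finite `A ⊆ ℤ^d`, the point process `𝒳^{u,ρ}[A]`
of trajectories of `𝒳^{u,ρ}` meeting `A` is a Poisson point process with intensity
`u·π_A`, where
`π_A = Σ_{x∈A} Σ_{m,l} (ρ(m+l)/(μ₁(ρ)+1))·P^x[H̃_A > m]·μ(x,m,l;A)`. -/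
theorem fri_restriction_is_ppp
    (d : ℕ) (hd : 4 ≤ d) (u : ℝ) (hu : 0 < u)
    (ρ : ℕ → ℝ) (hρ : IsDist ρ) (hmean : 0 < mu 1 ρ)
    (hsum : Summable fun l : ℕ => (l : ℝ) * ρ l)
    (Pw : Zd d → Measure (ℕ → Zd d)) (hPw : IsSRWFamily d Pw)
    (A : Finset (Zd d))
    (P : Measure (Config d)) (hP : IsFRI d u ρ P) :
    IsPoissonPP d (fun η => u * piA d Pw ρ A η) (P.map (restrictConfig A)) := by
  simp only [aux_piA d u ρ Pw hPw A]
  obtain ⟨hprob, hcyl⟩ := hP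
  have hmeas := aux_meas_restrict (d := d) A
  refine ⟨Measure.isProbabilityMeasure_map hmeas.aemeasurable, fun F k => ?_⟩
  have hset : MeasurableSet {ω : Config d | ∀ η ∈ F, ω η = k η} := by
    have : {ω : Config d | ∀ η ∈ F, ω η = k η} =
        ⋂ η ∈ F, (fun ω : Config d => ω η) ⁻¹' {k η} := by
      ext ω; simp
    rw [this]
    exact Finset.measurableSet_biInter F fun η _ =>
      measurable_pi_apply η (measurableSet_singleton _)
  rw [Measure.map_apply hmeas hset]
  by_cases hbad : ∃ η ∈ F, ¬ hits η (↑A) ∧ k η ≠ 0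
  · obtain ⟨η, hF, hn, hk⟩ := hbad
    have he : restrictConfig A ⁻¹' {ω : Config d | ∀ η ∈ F, ω η = k η} = ∅ := by
      ext ω
      simp only [Set.mem_preimage, Set.mem_setOf_eq, Set.mem_empty_iff_false, iff_false]
      intro h
      have := h η hF
      rw [restrictConfig, if_neg hn] at this
      exact hk this.symm
    rw [he, measure_empty, Finset.prod_eq_zero hF]
    beta_reduce
    rw [if_neg hn, aux_poisson_zero, if_neg hk]
  · push Not at hbad
    have he : restrictConfig A ⁻¹' {ω : Config d | ∀ η ∈ F, ω η = k η} =
        {ω : Config d | ∀ η ∈ F.filter (fun η => hits η (↑A)), ω η = k η} := by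
      ext ω
      simp only [Set.mem_preimage, Set.mem_setOf_eq, Finset.mem_filter, restrictConfig]
      constructor
      · rintro h η ⟨hF, hη⟩
        have := h η hF
        rwa [if_pos hη] at this
      · intro h η hF
        split_ifs with hη
        · exact h η ⟨hF, hη⟩
        · exact (hbad η hF hη).symm
    rw [he, hcyl, Finset.prod_filter]
    refine Finset.prod_congr rfl fun η hF => ?_
    beta_reduce
    split_ifs with hη
    · rfl
    · rw [aux_poisson_zero, if_pos (hbad η hF hη)]

end FRIPaper
end
end
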